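/- arXiv:1805.10721 — 6 statements merged into one kernel-verified Lean document; each statement's English description precedes it below -/
import Mathlib

section
/- Let P be the transition probability matrix of a finite-state, irreducible Markov chain that is reversible with respect to its invariant distribution π, and suppose its second largest eigenvalue λ₊ satisfies λ₊ ∈ [0,1). Let f : 𝒳 → [−c, +c] satisfy π(f) = 0 and π(f²) = σ². Then for every t with 0 ≤ t < (1−λ₊)/(5c), ‖E^{t f/2} P E^{t f/2}‖_π ≤ exp( (σ²/c²)(e^{tc} − 1 − tc) + σ² ‖P − Π‖_π t² / (1 − λ₊ − 5ct) ). -/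
open MeasureTheory Filter Real

variable {𝒳 : Type*} [Fintype 𝒳] [DecidableEq 𝒳]

/-- The operator norm of a matrix `T` acting on `ℝ^𝒳` equipped with the `pi`-weighted
inner product `⟨u, v⟩_pi = Σ_x pi x * u x * v x`. -/
noncomputable def weightedOpNorm (pi : 𝒳 → ℝ) (T : Matrix 𝒳 𝒳 ℝ) : ℝ :=
  sSup {r : ℝ | ∃ u : 𝒳 → ℝ, (∑ x, pi x * (u x) ^ 2) ≤ 1 ∧
    r = Real.sqrt (∑ x, pi x * (T.mulVec u x) ^ 2)}

/-- The matrix of the projection `h ↦ (Σ_x pi x * h x) • 1` on `ℝ^𝒳`. -/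
def projMatrix (pi : 𝒳 → ℝ) : Matrix 𝒳 𝒳 ℝ := Matrix.of fun _ y => pi y

/-- `P` is a row-stochastic matrix. -/
def IsStochasticMatrix (P : Matrix 𝒳 𝒳 ℝ) : Prop :=
  (∀ x y, 0 ≤ P x y) ∧ ∀ x, ∑ y, P x y = 1

/-- `P` is irreducible: any state can reach any other state. -/
def IsIrreducibleMatrix (P : Matrix 𝒳 𝒳 ℝ) : Prop :=
  ∀ x y, ∃ n : ℕ, 0 < (P ^ n) x y

/-- `pi` is an invariant probability distribution for `P`. -/
def IsInvariantDistrib (pi : 𝒳 → ℝ) (P : Matrix 𝒳 𝒳 ℝ) : Prop :=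
  (∀ x, 0 ≤ pi x) ∧ (∑ x, pi x = 1) ∧ ∀ y, ∑ x, pi x * P x y = pi y

/-- `P` is reversible with respect to `pi`. -/
def IsReversible (pi : 𝒳 → ℝ) (P : Matrix 𝒳 𝒳 ℝ) : Prop :=
  ∀ x y, pi x * P x y = pi y * P y x

omit [DecidableEq 𝒳] in
/-- A `pi`-self-adjoint matrix is bounded in norm by any bound on its quadratic form. -/
theorem weightedOpNorm_le_of_abs_quadForm_le (pi : 𝒳 → ℝ)
    (T : Matrix 𝒳 𝒳 ℝ) (hT : ∀ x y, pi x * T x y = pi y * T y x) (K : ℝ) (hK : 0 < K)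
    (h : ∀ u : 𝒳 → ℝ, |∑ x, pi x * u x * T.mulVec u x| ≤ K * ∑ x, pi x * (u x) ^ 2) :
    weightedOpNorm pi T ≤ K := by
  have hsymm : ∀ u v : 𝒳 → ℝ,
      ∑ x, pi x * u x * T.mulVec v x = ∑ x, pi x * v x * T.mulVec u x := by
    intro u v
    simp only [Matrix.mulVec, dotProduct, Finset.mul_sum]
    rw [Finset.sum_comm]
    refine Finset.sum_congr rfl fun x _ => Finset.sum_congr rfl fun y _ => ?_
    linear_combination u y * v x * hT y x
  refine csSup_le ⟨_, 0, by simp, rfl⟩ ?_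
  rintro r ⟨u, hu, rfl⟩
  refine Real.sqrt_le_iff.2 ⟨hK.le, ?_⟩
  set w := T.mulVec u with hw
  have hplus := (abs_le.1 (h (w + K • u))).2
  have hminus := (abs_le.1 (h (w - K • u))).1
  have hwu : ∑ x, pi x * u x * T.mulVec w x = ∑ x, pi x * w x ^ 2 := by
    rw [hsymm u w]
    exact Finset.sum_congr rfl fun x _ => by rw [← hw]; ring
  have hqp : ∑ x, pi x * (w + K • u) x * T.mulVec (w + K • u) x
      = ∑ x, pi x * w x * T.mulVec w x + K ^ 2 * ∑ x, pi x * u x * w x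
        + 2 * K * ∑ x, pi x * w x ^ 2 := by
    rw [two_mul K, add_mul]
    nth_rewrite 2 [← hwu]
    simp only [Finset.mul_sum, ← Finset.sum_add_distrib, Matrix.mulVec_add, Matrix.mulVec_smul,
      ← hw, Pi.add_apply, Pi.smul_apply, smul_eq_mul]
    exact Finset.sum_congr rfl fun x _ => by ring
  have hqm : ∑ x, pi x * (w - K • u) x * T.mulVec (w - K • u) x
      = ∑ x, pi x * w x * T.mulVec w x + K ^ 2 * ∑ x, pi x * u x * w x
        - 2 * K * ∑ x, pi x * w x ^ 2 := by
    rw [two_mul K, add_mul]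
    nth_rewrite 2 [← hwu]
    simp only [Finset.mul_sum, ← Finset.sum_add_distrib, ← Finset.sum_sub_distrib,
      Matrix.mulVec_sub, Matrix.mulVec_smul, ← hw, Pi.sub_apply, Pi.smul_apply, smul_eq_mul]
    exact Finset.sum_congr rfl fun x _ => by ring
  have hpar : ∑ x, pi x * (w + K • u) x ^ 2 + ∑ x, pi x * (w - K • u) x ^ 2
      = 2 * ∑ x, pi x * w x ^ 2 + 2 * K ^ 2 * ∑ x, pi x * u x ^ 2 := by
    simp only [Finset.mul_sum, ← Finset.sum_add_distrib, Pi.add_apply, Pi.sub_apply,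
      Pi.smul_apply, smul_eq_mul]
    exact Finset.sum_congr rfl fun x _ => by ring
  rw [hqp] at hplus
  rw [hqm] at hminus
  have hle : K * (∑ x, pi x * w x ^ 2) ≤ K * (K ^ 2 * ∑ x, pi x * u x ^ 2) := by
    have : K * _ = K * _ := congrArg (K * ·) hpar
    linarith
  nlinarith [le_of_mul_le_mul_left hle hK, sq_nonneg K]

omit [DecidableEq 𝒳] in
/-- The matrix `P` contracts the weighted `L²`-norm of its invariant distribution. -/
theorem sum_mulVec_sq_le {pi : 𝒳 → ℝ} {P : Matrix 𝒳 𝒳 ℝ} (hP : IsStochasticMatrix P)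
    (hpi : IsInvariantDistrib pi P) (u : 𝒳 → ℝ) :
    ∑ x, pi x * (P.mulVec u x) ^ 2 ≤ ∑ x, pi x * (u x) ^ 2 := by
  have hjensen : ∀ x, (P.mulVec u x) ^ 2 ≤ ∑ y, P x y * u y ^ 2 := by
    intro x
    have := Finset.sum_sq_le_sum_mul_sum_of_sq_le_mul Finset.univ
      (r := fun y => P x y * u y) (f := fun y => P x y) (g := fun y => P x y * u y ^ 2)
      (fun y _ => hP.1 x y) (fun y _ => mul_nonneg (hP.1 x y) (sq_nonneg _)) (fun y _ => le_of_eq (by ring))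
    rwa [hP.2 x, one_mul] at this
  calc ∑ x, pi x * (P.mulVec u x) ^ 2 ≤ ∑ x, pi x * ∑ y, P x y * u y ^ 2 :=
        Finset.sum_le_sum fun x _ => mul_le_mul_of_nonneg_left (hjensen x) (hpi.1 x)
    _ = ∑ y, (∑ x, pi x * P x y) * u y ^ 2 := by
        simp only [Finset.mul_sum, Finset.sum_mul]
        rw [Finset.sum_comm]
        exact Finset.sum_congr rfl fun x _ => Finset.sum_congr rfl fun y _ => by ring
    _ = ∑ x, pi x * (u x) ^ 2 := by simp only [hpi.2.2]

omit [DecidableEq 𝒳] in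
theorem sq_sum_le {pi : 𝒳 → ℝ} (h0 : ∀ x, 0 ≤ pi x) (h1 : ∑ x, pi x = 1) (u : 𝒳 → ℝ) :
    (∑ x, pi x * u x) ^ 2 ≤ ∑ x, pi x * (u x) ^ 2 := by
  have := Finset.sum_sq_le_sum_mul_sum_of_sq_le_mul Finset.univ
    (r := fun y => pi y * u y) (f := pi) (g := fun y => pi y * u y ^ 2)
    (fun y _ => h0 y) (fun y _ => mul_nonneg (h0 y) (sq_nonneg _)) (fun y _ => le_of_eq (by ring))
  rwa [h1, one_mul] at this

omit [DecidableEq 𝒳] in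
theorem projMatrix_mulVec (pi u : 𝒳 → ℝ) (x : 𝒳) :
    (projMatrix pi).mulVec u x = ∑ y, pi y * u y := rfl

omit [DecidableEq 𝒳] in
theorem bddAbove_sub_projMatrix {pi : 𝒳 → ℝ} {P : Matrix 𝒳 𝒳 ℝ} (hP : IsStochasticMatrix P)
    (hpi : IsInvariantDistrib pi P) :
    BddAbove {r : ℝ | ∃ u : 𝒳 → ℝ, (∑ x, pi x * (u x) ^ 2) ≤ 1 ∧
      r = Real.sqrt (∑ x, pi x * ((P - projMatrix pi).mulVec u x) ^ 2)} := by
  refine ⟨2, ?_⟩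
  rintro r ⟨u, hu, rfl⟩
  refine Real.sqrt_le_iff.2 ⟨by norm_num, ?_⟩
  set a := ∑ y, pi y * u y with ha
  have hsum : ∑ x, pi x * (2 * (P.mulVec u x) ^ 2 + 2 * a ^ 2)
      = 2 * ∑ x, pi x * (P.mulVec u x) ^ 2 + 2 * a ^ 2 := by
    simp only [mul_add, Finset.sum_add_distrib, ← Finset.sum_mul, hpi.2.1, Finset.mul_sum, one_mul]
    congr 1
    exact Finset.sum_congr rfl fun x _ => by ring
  calc ∑ x, pi x * ((P - projMatrix pi).mulVec u x) ^ 2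
      ≤ ∑ x, pi x * (2 * (P.mulVec u x) ^ 2 + 2 * a ^ 2) := by
        refine Finset.sum_le_sum fun x _ => mul_le_mul_of_nonneg_left ?_ (hpi.1 x)
        rw [Matrix.sub_mulVec, Pi.sub_apply, projMatrix_mulVec, ← ha]
        nlinarith [sq_nonneg (P.mulVec u x + a)]
    _ ≤ 2 ^ 2 := by
        rw [hsum]
        linarith [sum_mulVec_sq_le hP hpi u, sq_sum_le hpi.1 hpi.2.1 u]

omit [DecidableEq 𝒳] in
theorem weightedOpNorm_nonneg (pi : 𝒳 → ℝ) (T : Matrix 𝒳 𝒳 ℝ) : 0 ≤ weightedOpNorm pi T := by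
  refine Real.sSup_nonneg ?_
  rintro r ⟨u, -, rfl⟩
  exact Real.sqrt_nonneg _

omit [DecidableEq 𝒳] in
/-- On mean-zero functions of positive norm, the quadratic form of `P` is bounded by the norm of
`P - Π`. -/
theorem quadForm_le_weightedOpNorm {pi : 𝒳 → ℝ} {P : Matrix 𝒳 𝒳 ℝ} (hP : IsStochasticMatrix P)
    (hpi : IsInvariantDistrib pi P) (w : 𝒳 → ℝ) (hw : ∑ x, pi x * w x = 0)
    (hpos : 0 < ∑ x, pi x * (w x) ^ 2) :
    ∑ x, pi x * w x * P.mulVec w x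
      ≤ weightedOpNorm pi (P - projMatrix pi) * ∑ x, pi x * (w x) ^ 2 := by
  set W := ∑ x, pi x * (w x) ^ 2 with hW
  set N := weightedOpNorm pi (P - projMatrix pi) with hN
  have hs : 0 < Real.sqrt W := Real.sqrt_pos.2 hpos
  have hss : Real.sqrt W ^ 2 = W := Real.sq_sqrt hpos.le
  have hunit : ∑ x, pi x * (((Real.sqrt W)⁻¹ • w) x) ^ 2 = 1 := by
    have : ∑ x, pi x * (((Real.sqrt W)⁻¹ • w) x) ^ 2 = ((Real.sqrt W)⁻¹) ^ 2 * W := by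
      rw [hW, Finset.mul_sum, ← hW]
      exact Finset.sum_congr rfl fun x _ => by simp only [Pi.smul_apply, smul_eq_mul]; ring
    rw [this, inv_pow, hss, inv_mul_cancel₀ hpos.ne']
  have hle := le_csSup (bddAbove_sub_projMatrix hP hpi) ⟨(Real.sqrt W)⁻¹ • w, hunit.le, rfl⟩
  have hPw : ∀ x, (P - projMatrix pi).mulVec ((Real.sqrt W)⁻¹ • w) x
      = (Real.sqrt W)⁻¹ * P.mulVec w x := by
    intro x
    rw [Matrix.mulVec_smul, Matrix.sub_mulVec, Pi.smul_apply, Pi.sub_apply, projMatrix_mulVec, hw,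
      sub_zero, smul_eq_mul]
  have hsq : ∑ x, pi x * (P.mulVec w x) ^ 2 ≤ N ^ 2 * W := by
    have h1 := (Real.sqrt_le_left (weightedOpNorm_nonneg pi (P - projMatrix pi))).1 hle
    have h2 : ∑ x, pi x * ((P - projMatrix pi).mulVec ((Real.sqrt W)⁻¹ • w) x) ^ 2
        = W⁻¹ * ∑ x, pi x * (P.mulVec w x) ^ 2 := by
      rw [Finset.mul_sum]
      refine Finset.sum_congr rfl fun x _ => ?_
      rw [hPw, mul_pow, inv_pow, hss]
      ring
    rw [h2, inv_mul_le_iff₀ hpos, mul_comm] at h1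
    exact h1
  have hcs := Finset.sum_sq_le_sum_mul_sum_of_sq_le_mul Finset.univ
    (r := fun x => pi x * w x * P.mulVec w x) (f := fun x => pi x * w x ^ 2)
    (g := fun x => pi x * P.mulVec w x ^ 2)
    (fun x _ => mul_nonneg (hpi.1 x) (sq_nonneg _))
    (fun x _ => mul_nonneg (hpi.1 x) (sq_nonneg _)) (fun x _ => le_of_eq (by ring))
  rw [← hW] at hcs
  refine abs_le_of_sq_le_sq' ?_ (mul_nonneg (weightedOpNorm_nonneg _ _) hpos.le) |>.2
  calc _ ≤ W * ∑ x, pi x * (P.mulVec w x) ^ 2 := hcs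
    _ ≤ W * (N ^ 2 * W) := mul_le_mul_of_nonneg_left hsq hpos.le
    _ = (N * W) ^ 2 := by ring

omit [DecidableEq 𝒳] in
theorem quadForm_eq_centered_add_sq {pi : 𝒳 → ℝ} {P : Matrix 𝒳 𝒳 ℝ} (hP : IsStochasticMatrix P)
    (hpi : IsInvariantDistrib pi P) (v : 𝒳 → ℝ) (a : ℝ) (ha : ∑ x, pi x * v x = a) :
    ∑ x, pi x * v x * P.mulVec v x
      = ∑ x, pi x * (v x - a) * P.mulVec (fun y => v y - a) x + a ^ 2 := by
  have hPv : ∀ x, P.mulVec (fun y => v y - a) x = P.mulVec v x - a := by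
    intro x
    simp only [Matrix.mulVec, dotProduct, mul_sub, Finset.sum_sub_distrib, ← Finset.sum_mul,
      hP.2 x, one_mul]
  have hinv : ∑ x, pi x * P.mulVec v x = a := by
    rw [← ha]
    simp only [Matrix.mulVec, dotProduct, Finset.mul_sum]
    rw [Finset.sum_comm]
    refine Finset.sum_congr rfl fun y _ => ?_
    rw [← hpi.2.2 y, Finset.sum_mul]
    exact Finset.sum_congr rfl fun x _ => by ring
  have hexp : ∑ x, pi x * (v x - a) * P.mulVec (fun y => v y - a) x
      = ∑ x, pi x * v x * P.mulVec v x - a * ∑ x, pi x * P.mulVec v x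
        - a * ∑ x, pi x * v x + a ^ 2 * ∑ x, pi x := by
    simp only [Finset.mul_sum, ← Finset.sum_sub_distrib, ← Finset.sum_add_distrib, hPv]
    exact Finset.sum_congr rfl fun x _ => by ring
  rw [hexp, hinv, ha, hpi.2.1]
  ring

omit [DecidableEq 𝒳] in
theorem sum_centered_sq {pi : 𝒳 → ℝ} (h1 : ∑ x, pi x = 1) (v : 𝒳 → ℝ) (a : ℝ)
    (ha : ∑ x, pi x * v x = a) :
    ∑ x, pi x * (v x - a) ^ 2 = ∑ x, pi x * v x ^ 2 - a ^ 2 := by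
  have : ∑ x, pi x * (v x - a) ^ 2
      = ∑ x, pi x * v x ^ 2 - 2 * a * ∑ x, pi x * v x + a ^ 2 * ∑ x, pi x := by
    simp only [Finset.mul_sum, ← Finset.sum_sub_distrib, ← Finset.sum_add_distrib]
    exact Finset.sum_congr rfl fun x _ => by ring
  rw [this, ha, h1]
  ring

/-- The function `y ↦ (exp y - 1 - y) / y ^ 2` is maximal at the right end of a symmetric
interval. -/
theorem exp_mul_sub_one_sub_le {c t y : ℝ} (hc : 0 < c) (ht : 0 ≤ t) (hy : |y| ≤ c) :
    Real.exp (t * y) - 1 - t * y ≤ y ^ 2 / c ^ 2 * (Real.exp (t * c) - 1 - t * c) := by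
  have hasSum_tail : ∀ z : ℝ, HasSum (fun n : ℕ => z ^ (n + 2) / ((n + 2).factorial : ℝ))
      (Real.exp z - 1 - z) := by
    intro z
    have h := NormedSpace.expSeries_div_hasSum_exp z
    rw [← Real.exp_eq_exp_ℝ] at h
    have h2 := (hasSum_nat_add_iff' 2).2 h
    simpa [Finset.sum_range_succ, sub_sub] using h2
  refine hasSum_le (fun n => ?_) (hasSum_tail (t * y)) ((hasSum_tail (t * c)).mul_left _)
  have hpow : y ^ n ≤ c ^ n :=
    (le_abs_self _).trans (by rw [abs_pow]; exact pow_le_pow_left₀ (abs_nonneg y) hy n)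
  have hrw : y ^ 2 / c ^ 2 * ((t * c) ^ (n + 2) / ((n + 2).factorial : ℝ))
      = y ^ 2 * (t ^ (n + 2) * c ^ n) / ((n + 2).factorial : ℝ) := by
    rw [mul_pow t c, pow_add c]
    field_simp
  rw [hrw]
  gcongr
  calc (t * y) ^ (n + 2) = y ^ 2 * (t ^ (n + 2) * y ^ n) := by ring
    _ ≤ y ^ 2 * (t ^ (n + 2) * c ^ n) := by gcongr

theorem exp_sub_one_sq_div_le {κ K τ y : ℝ} (hκ0 : 0 ≤ κ) (hκ1 : κ ≤ 1) (hK : 1 ≤ K)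
    (hτ : 5 * τ < 1 - κ) (hy : |y| ≤ τ) :
    0 < K - κ * Real.exp y ∧
      (Real.exp y - 1) ^ 2 / (K - κ * Real.exp y) ≤ y ^ 2 / (1 - κ - 5 * τ) := by
  have hτ0 : 0 ≤ τ := (abs_nonneg y).trans hy
  have hy2 : y ^ 2 ≤ τ * |y| := by
    rw [← sq_abs]
    nlinarith [abs_nonneg y]
  have hexp := abs_le.1 (Real.abs_exp_sub_one_sub_id_le (x := y) (by linarith))
  have hsq : (Real.exp y - 1) ^ 2 ≤ y ^ 2 * (1 + τ) ^ 2 := by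
    rw [← sq_abs y, ← mul_pow]
    refine sq_le_sq' ?_ ?_
    · linarith [neg_abs_le y]
    · linarith [le_abs_self y]
  have hle : Real.exp y ≤ 1 + 6 / 5 * τ := by
    nlinarith [le_abs_self y, abs_nonneg y]
  have hden : 1 - κ - 6 / 5 * τ ≤ K - κ * Real.exp y := by
    nlinarith
  have hpos : 0 < K - κ * Real.exp y := by linarith
  refine ⟨hpos, ?_⟩
  rw [div_le_div_iff₀ hpos (by linarith)]
  have hfac : (1 + τ) ^ 2 * (1 - κ - 5 * τ) ≤ K - κ * Real.exp y := by
    refine le_trans ?_ hden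
    have h1 : (1 + τ) ^ 2 ≤ 1 + 11 / 5 * τ := by nlinarith
    have h2 := mul_le_mul_of_nonneg_right h1 (show 0 ≤ 1 - κ - 5 * τ by linarith)
    nlinarith [mul_nonneg hτ0 hκ0]
  calc (Real.exp y - 1) ^ 2 * (1 - κ - 5 * τ) ≤ y ^ 2 * (1 + τ) ^ 2 * (1 - κ - 5 * τ) :=
        mul_le_mul_of_nonneg_right hsq (by linarith)
    _ = y ^ 2 * ((1 + τ) ^ 2 * (1 - κ - 5 * τ)) := by ring
    _ ≤ y ^ 2 * (K - κ * Real.exp y) := mul_le_mul_of_nonneg_left hfac (sq_nonneg y)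

omit [DecidableEq 𝒳] in
/-- The bound for the tilted kernel `κ I + (1 - κ) Π`, in quadratic-form version. -/
theorem tilted_leonPerron_quadForm_le {pi : 𝒳 → ℝ} (h0 : ∀ x, 0 ≤ pi x) (h1 : ∑ x, pi x = 1)
    {κ c t σ2 : ℝ} (hκ0 : 0 ≤ κ) (hκ1 : κ < 1) (hc : 0 < c) {f : 𝒳 → ℝ} (hfb : ∀ x, |f x| ≤ c)
    (hf0 : ∑ x, pi x * f x = 0) (hσ2 : ∑ x, pi x * (f x) ^ 2 = σ2) (ht0 : 0 ≤ t)
    (ht : 5 * (c * t) < 1 - κ) (u : 𝒳 → ℝ) :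
    κ * (∑ x, pi x * (Real.exp (t * f x / 2) * u x) ^ 2)
        + (1 - κ) * (∑ x, pi x * (Real.exp (t * f x / 2) * u x)) ^ 2
      ≤ Real.exp (σ2 / c ^ 2 * (Real.exp (t * c) - 1 - t * c)
          + σ2 * κ * t ^ 2 / (1 - κ - 5 * (c * t))) * ∑ x, pi x * u x ^ 2 := by
  have hσ0 : 0 ≤ σ2 := hσ2 ▸ Finset.sum_nonneg fun x _ => mul_nonneg (h0 x) (sq_nonneg _)
  set L := σ2 / c ^ 2 * (Real.exp (t * c) - 1 - t * c)
    + σ2 * κ * t ^ 2 / (1 - κ - 5 * (c * t)) with hL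
  set K := Real.exp L with hK
  have hd : 0 < 1 - κ - 5 * (c * t) := by linarith
  have hL0 : 0 ≤ L := by
    have : 0 ≤ Real.exp (t * c) - 1 - t * c := by linarith [Real.add_one_le_exp (t * c)]
    positivity
  have hLK : L ≤ K - 1 := by linarith [Real.add_one_le_exp L]
  have hK1 : 1 ≤ K := by linarith
  have hty : ∀ x, |t * f x| ≤ c * t := by
    intro x
    rw [abs_mul, abs_of_nonneg ht0, mul_comm]
    exact mul_le_mul_of_nonneg_right (hfb x) ht0
  have hD := fun x => exp_sub_one_sq_div_le hκ0 hκ1.le hK1 ht (hty x)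
  have hKκ : 0 < K - κ := by linarith
  have hpoint : ∀ x, Real.exp (t * f x) / (K - κ * Real.exp (t * f x))
      ≤ 1 / (K - κ) + K / (K - κ) ^ 2 * (t * f x)
        + K / (K - κ) ^ 2 * (((Real.exp (t * c) - 1 - t * c) / c ^ 2
          + κ * t ^ 2 / (1 - κ - 5 * (c * t))) * f x ^ 2) := by
    intro x
    obtain ⟨hpos, hle⟩ := hD x
    have hexact : Real.exp (t * f x) / (K - κ * Real.exp (t * f x))
        = 1 / (K - κ) + K / (K - κ) ^ 2 * (t * f x)
          + K / (K - κ) ^ 2 * ((Real.exp (t * f x) - 1 - t * f x)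
            + κ * ((Real.exp (t * f x) - 1) ^ 2 / (K - κ * Real.exp (t * f x)))) := by
      have h2 := hpos.ne'
      have h3 := hKκ.ne'
      generalize Real.exp (t * f x) = e at h2 ⊢
      generalize t * f x = z
      rw [mul_comm κ e] at h2 ⊢
      field_simp
      ring
    rw [hexact]
    have h2 := exp_mul_sub_one_sub_le hc ht0 (hfb x)
    have h3 := mul_le_mul_of_nonneg_left hle hκ0
    gcongr
    calc _ ≤ f x ^ 2 / c ^ 2 * (Real.exp (t * c) - 1 - t * c)
          + κ * ((t * f x) ^ 2 / (1 - κ - 5 * (c * t))) := add_le_add h2 h3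
      _ = _ := by ring
  have hmean : (1 - κ) * ∑ x, pi x * (Real.exp (t * f x) / (K - κ * Real.exp (t * f x))) ≤ 1 := by
    have hsum : ∑ x, pi x * (Real.exp (t * f x) / (K - κ * Real.exp (t * f x)))
        ≤ 1 / (K - κ) + K / (K - κ) ^ 2 * L := by
      refine (Finset.sum_le_sum fun x _ =>
        mul_le_mul_of_nonneg_left (hpoint x) (h0 x)).trans (le_of_eq ?_)
      set A := (Real.exp (t * c) - 1 - t * c) / c ^ 2 + κ * t ^ 2 / (1 - κ - 5 * (c * t)) with hA
      have hLA : L = A * σ2 := by rw [hL, hA]; ring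
      have hlin : ∑ x, pi x * (1 / (K - κ) + K / (K - κ) ^ 2 * (t * f x)
            + K / (K - κ) ^ 2 * (A * f x ^ 2))
          = 1 / (K - κ) * ∑ x, pi x + K / (K - κ) ^ 2 * t * ∑ x, pi x * f x
            + K / (K - κ) ^ 2 * A * ∑ x, pi x * f x ^ 2 := by
        simp only [Finset.mul_sum, ← Finset.sum_add_distrib]
        exact Finset.sum_congr rfl fun x _ => by ring
      rw [hlin, h1, hf0, hσ2, hLA]
      ring
    refine (mul_le_mul_of_nonneg_left hsum (by linarith)).trans ?_
    have hrw : (1 - κ) * (1 / (K - κ) + K / (K - κ) ^ 2 * L)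
        = ((1 - κ) * (K - κ) + (1 - κ) * K * L) / (K - κ) ^ 2 := by
      have := hKκ.ne'
      field_simp
    rw [hrw, div_le_one (by positivity)]
    have h2 : (1 - κ) * K ≤ K - κ := by nlinarith
    have h3 : (1 - κ) * K * L ≤ (K - κ) * (K - 1) := mul_le_mul h2 hLK hL0 hKκ.le
    nlinarith
  have hexp2 : ∀ x, Real.exp (t * f x / 2) ^ 2 = Real.exp (t * f x) := by
    intro x
    rw [← Real.exp_nat_mul]
    congr 1
    push_cast
    ring
  have hcs := Finset.sum_sq_le_sum_mul_sum_of_sq_le_mul Finset.univ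
    (r := fun x => pi x * (Real.exp (t * f x / 2) * u x))
    (f := fun x => pi x * (Real.exp (t * f x) / (K - κ * Real.exp (t * f x))))
    (g := fun x => pi x * ((K - κ * Real.exp (t * f x)) * u x ^ 2))
    (fun x _ => mul_nonneg (h0 x) (div_nonneg (Real.exp_pos _).le (hD x).1.le))
    (fun x _ => mul_nonneg (h0 x) (mul_nonneg (hD x).1.le (sq_nonneg _)))
    (fun x _ => by
      rw [mul_pow, mul_pow, hexp2]
      have hne := (hD x).1.ne'
      generalize Real.exp (t * f x) = e at hne ⊢
      rw [show pi x * (e / (K - κ * e)) * (pi x * ((K - κ * e) * u x ^ 2))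
        = pi x ^ 2 * (u x ^ 2 * (e / (K - κ * e) * (K - κ * e))) by ring, div_mul_cancel₀ _ hne]
      exact le_of_eq (by ring))
  have hG : 0 ≤ ∑ x, pi x * ((K - κ * Real.exp (t * f x)) * u x ^ 2) :=
    Finset.sum_nonneg fun x _ => mul_nonneg (h0 x) (mul_nonneg (hD x).1.le (sq_nonneg _))
  have hsplit : ∑ x, pi x * ((K - κ * Real.exp (t * f x)) * u x ^ 2)
      = K * ∑ x, pi x * u x ^ 2 - κ * ∑ x, pi x * (Real.exp (t * f x / 2) * u x) ^ 2 := by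
    simp only [Finset.mul_sum, ← Finset.sum_sub_distrib, mul_pow, hexp2]
    exact Finset.sum_congr rfl fun x _ => by ring
  have hfin := mul_le_mul_of_nonneg_left hcs (show 0 ≤ 1 - κ by linarith)
  rw [← mul_assoc] at hfin
  have := hfin.trans (mul_le_mul_of_nonneg_right hmean hG)
  linarith

/-- **Lemma 3.3.** Let `P` be the transition matrix of a finite-state, irreducible Markov
chain, reversible with respect to its invariant distribution `pi`, whose second largest
eigenvalue `λ₊` (the largest point of the spectrum on the mean-zero subspace, characterized
by the Rayleigh-quotient bound below) lies in `[0,1)`. If `f : 𝒳 → [-c, c]`, `pi(f) = 0`,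
`pi(f²) = σ²`, then for `0 ≤ t < (1-λ₊)/(5c)`,
`‖E^{t f/2} P E^{t f/2}‖_pi ≤ exp(σ²/c² (e^{tc} - 1 - tc) + σ² ‖P - Π‖_pi t²/(1-λ₊-5ct))`. -/
theorem tilted_matrix_norm_le
    (P : Matrix 𝒳 𝒳 ℝ) (pi : 𝒳 → ℝ)
    (hP : IsStochasticMatrix P) (hirr : IsIrreducibleMatrix P)
    (hpi : IsInvariantDistrib pi P) (hrev : IsReversible pi P)
    (lamPlus : ℝ) (hlam0 : 0 ≤ lamPlus) (hlam1 : lamPlus < 1)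
    (hgap : ∀ u : 𝒳 → ℝ, (∑ x, pi x * u x) = 0 →
      ∑ x, pi x * u x * P.mulVec u x ≤ lamPlus * ∑ x, pi x * (u x) ^ 2)
    (c : ℝ) (hc : 0 < c) (f : 𝒳 → ℝ) (hfb : ∀ x, |f x| ≤ c)
    (hf0 : (∑ x, pi x * f x) = 0) (σ2 : ℝ) (hσ2 : (∑ x, pi x * (f x) ^ 2) = σ2)
    (t : ℝ) (ht0 : 0 ≤ t) (ht : t < (1 - lamPlus) / (5 * c)) :
    weightedOpNorm pi
        (Matrix.of fun x y => Real.exp (t * f x / 2) * P x y * Real.exp (t * f y / 2)) ≤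
      Real.exp (σ2 / c ^ 2 * (Real.exp (t * c) - 1 - t * c) +
        σ2 * weightedOpNorm pi (P - projMatrix pi) * t ^ 2 / (1 - lamPlus - 5 * c * t)) := by
  have ht5 : 5 * (c * t) < 1 - lamPlus := by
    rw [lt_div_iff₀ (by positivity)] at ht
    linarith
  set N := weightedOpNorm pi (P - projMatrix pi) with hN
  have hN0 : 0 ≤ N := weightedOpNorm_nonneg _ _
  have hσ0 : 0 ≤ σ2 := hσ2 ▸ Finset.sum_nonneg fun x _ => mul_nonneg (hpi.1 x) (sq_nonneg _)
  set κ := min lamPlus N with hκ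
  have hκ0 : 0 ≤ κ := le_min hlam0 hN0
  have hκlam : κ ≤ lamPlus := min_le_left _ _
  have hκN : κ ≤ N := min_le_right _ _
  have hcentered : ∀ w : 𝒳 → ℝ, ∑ x, pi x * w x = 0 →
      ∑ x, pi x * w x * P.mulVec w x ≤ κ * ∑ x, pi x * (w x) ^ 2 := by
    intro w hw
    have h1 := hgap w hw
    have hnn : 0 ≤ ∑ x, pi x * (w x) ^ 2 :=
      Finset.sum_nonneg fun x _ => mul_nonneg (hpi.1 x) (sq_nonneg _)
    rcases hnn.eq_or_lt with h | h
    · rw [← h, mul_zero] at h1 ⊢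
      exact h1
    · rw [hκ, min_mul_of_nonneg _ _ hnn]
      exact le_min h1 (quadForm_le_weightedOpNorm hP hpi w hw h)
  set K := Real.exp (σ2 / c ^ 2 * (Real.exp (t * c) - 1 - t * c)
    + σ2 * N * t ^ 2 / (1 - lamPlus - 5 * c * t)) with hK
  have hupper : ∀ u : 𝒳 → ℝ,
      ∑ x, pi x * (Real.exp (t * f x / 2) * u x)
          * P.mulVec (fun y => Real.exp (t * f y / 2) * u y) x
        ≤ K * ∑ x, pi x * u x ^ 2 := by
    intro u
    set v : 𝒳 → ℝ := fun y => Real.exp (t * f y / 2) * u y with hv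
    have h1 := quadForm_eq_centered_add_sq hP hpi v _ rfl
    have h2 := hcentered (fun x => v x - ∑ y, pi y * v y) (by
      simp only [mul_sub, Finset.sum_sub_distrib, ← Finset.sum_mul, hpi.2.1, one_mul, sub_self])
    rw [sum_centered_sq hpi.2.1 v _ rfl] at h2
    have h3 := tilted_leonPerron_quadForm_le hpi.1 hpi.2.1 hκ0 (hκlam.trans_lt hlam1) hc hfb hf0
      hσ2 ht0 (by linarith) u
    have h4 : Real.exp (σ2 / c ^ 2 * (Real.exp (t * c) - 1 - t * c)
        + σ2 * κ * t ^ 2 / (1 - κ - 5 * (c * t))) ≤ K := by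
      rw [hK, mul_assoc 5 c t]
      have : 0 < 1 - lamPlus - 5 * (c * t) := by linarith
      gcongr
    have h5 := mul_le_mul_of_nonneg_right h4 (show 0 ≤ ∑ x, pi x * u x ^ 2 from
      Finset.sum_nonneg fun x _ => mul_nonneg (hpi.1 x) (sq_nonneg _))
    linarith
  have hform : ∀ u : 𝒳 → ℝ, ∑ x, pi x * u x * (Matrix.of fun x y =>
        Real.exp (t * f x / 2) * P x y * Real.exp (t * f y / 2)).mulVec u x
      = ∑ x, pi x * (Real.exp (t * f x / 2) * u x)
          * P.mulVec (fun y => Real.exp (t * f y / 2) * u y) x := by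
    intro u
    simp only [Matrix.mulVec, dotProduct, Matrix.of_apply, Finset.mul_sum]
    exact Finset.sum_congr rfl fun x _ => Finset.sum_congr rfl fun y _ => by ring
  refine weightedOpNorm_le_of_abs_quadForm_le pi _ (fun x y => ?_) K (Real.exp_pos _)
    fun u => ?_
  · simp only [Matrix.of_apply]
    linear_combination Real.exp (t * f x / 2) * Real.exp (t * f y / 2) * hrev x y
  · have habs := hupper fun x => |u x|
    simp only [sq_abs] at habs
    rw [hform]
    refine le_trans ?_ habs
    simp only [Matrix.mulVec, dotProduct, Finset.mul_sum]
    refine (Finset.abs_sum_le_sum_abs _ _).trans (Finset.sum_le_sum fun x _ =>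
      (Finset.abs_sum_le_sum_abs _ _).trans (Finset.sum_le_sum fun y _ => le_of_eq ?_))
    simp only [abs_mul, Real.abs_exp, abs_of_nonneg (hpi.1 x), abs_of_nonneg (hP.1 x y)]
end

section
/- Let P be a finite-state, irreducible, row-stochastic matrix reversible with respect to its invariant distribution π, with second largest eigenvalue λ₊ < 1 and ‖P − Π‖_π < 1, and let Z = (I − P + Π)^{-1} − Π. Then: (i) ‖Zh‖_π ≤ ‖h‖_π/(1−λ₊) for all h; (ii) ⟨Zf, f⟩_π ≥ 0 for every f with π(f) = 0; and (iii) ⟨Zf, f⟩_π ≤ π(f²)/(1−λ₊) for every f with π(f) = 0. -/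
open MeasureTheory Filter Real

variable {𝒳 : Type*} [Fintype 𝒳] [DecidableEq 𝒳]

theorem IsInvariantDistrib.sum_mul_pow {pi : 𝒳 → ℝ} {P : Matrix 𝒳 𝒳 ℝ}
    (hpi : IsInvariantDistrib pi P) (n : ℕ) (y : 𝒳) : ∑ x, pi x * (P ^ n) x y = pi y := by
  have key : Matrix.vecMul pi (P ^ n) = pi := by
    induction n with
    | zero => simp
    | succ n ih =>
      rw [pow_succ, ← Matrix.vecMul_vecMul, ih]
      exact funext hpi.2.2
  exact congrFun key y

theorem IsStochasticMatrix.pow_nonneg {P : Matrix 𝒳 𝒳 ℝ} (hP : IsStochasticMatrix P) (n : ℕ)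
    (x y : 𝒳) : 0 ≤ (P ^ n) x y := by
  induction n generalizing x y with
  | zero =>
    rw [pow_zero, Matrix.one_apply]
    split_ifs <;> norm_num
  | succ n ih =>
    rw [pow_succ, Matrix.mul_apply]
    exact Finset.sum_nonneg fun z _ => mul_nonneg (ih x z) (hP.1 z y)

/-- The invariant distribution of an irreducible stochastic matrix charges every state. -/
theorem IsInvariantDistrib.pos {pi : 𝒳 → ℝ} {P : Matrix 𝒳 𝒳 ℝ} (hpi : IsInvariantDistrib pi P)
    (hP : IsStochasticMatrix P) (hirr : IsIrreducibleMatrix P) (x : 𝒳) : 0 < pi x := by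
  obtain ⟨y, -, hy⟩ : ∃ y ∈ Finset.univ, 0 < pi y :=
    Finset.exists_lt_of_sum_lt (f := fun _ => 0) (by simp [hpi.2.1])
  obtain ⟨n, hn⟩ := hirr y x
  rw [← hpi.sum_mul_pow n x]
  exact (mul_pos hy hn).trans_le <| Finset.single_le_sum (f := fun z => pi z * (P ^ n) z x)
    (fun z _ => mul_nonneg (hpi.1 z) (hP.pow_nonneg n z x)) (Finset.mem_univ y)

omit [DecidableEq 𝒳] in
theorem IsInvariantDistrib.sum_mul_mulVec {pi : 𝒳 → ℝ} {P : Matrix 𝒳 𝒳 ℝ}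
    (hpi : IsInvariantDistrib pi P) (u : 𝒳 → ℝ) :
    ∑ x, pi x * P.mulVec u x = ∑ x, pi x * u x := by
  have key : Matrix.vecMul pi P = pi := funext hpi.2.2
  change pi ⬝ᵥ P.mulVec u = pi ⬝ᵥ u
  rw [Matrix.dotProduct_mulVec, key]

theorem one_sub_add_projMatrix_mulVec (pi : 𝒳 → ℝ) (P : Matrix 𝒳 𝒳 ℝ) (u : 𝒳 → ℝ) (x : 𝒳) :
    (1 - P + projMatrix pi).mulVec u x = u x - P.mulVec u x + ∑ y, pi y * u y := by
  rw [Matrix.add_mulVec, Matrix.sub_mulVec, Matrix.one_mulVec, Pi.add_apply, Pi.sub_apply,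
    projMatrix_mulVec]

theorem IsInvariantDistrib.sum_mul_one_sub_add_projMatrix_mulVec {pi : 𝒳 → ℝ}
    {P : Matrix 𝒳 𝒳 ℝ} (hpi : IsInvariantDistrib pi P) (u : 𝒳 → ℝ) :
    ∑ x, pi x * (1 - P + projMatrix pi).mulVec u x = ∑ x, pi x * u x := by
  simp only [one_sub_add_projMatrix_mulVec, mul_add, mul_sub, Finset.sum_add_distrib,
    Finset.sum_sub_distrib, hpi.sum_mul_mulVec, ← Finset.sum_mul, hpi.2.1]
  ring

omit [DecidableEq 𝒳] in
/-- The Poincaré inequality: the spectral gap bounds the Dirichlet form from below. -/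
theorem dirichlet_lower_bound {pi : 𝒳 → ℝ} {P : Matrix 𝒳 𝒳 ℝ} {lamPlus : ℝ}
    (hgap : ∀ u : 𝒳 → ℝ, (∑ x, pi x * u x) = 0 →
      ∑ x, pi x * u x * P.mulVec u x ≤ lamPlus * ∑ x, pi x * (u x) ^ 2)
    {u : 𝒳 → ℝ} (hu : ∑ x, pi x * u x = 0) :
    (1 - lamPlus) * ∑ x, pi x * (u x) ^ 2 ≤ ∑ x, pi x * u x * (u x - P.mulVec u x) := by
  have h : ∑ x, pi x * u x * (u x - P.mulVec u x) =
      ∑ x, pi x * (u x) ^ 2 - ∑ x, pi x * u x * P.mulVec u x := by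
    rw [← Finset.sum_sub_distrib]
    exact Finset.sum_congr rfl fun x _ => by ring
  linarith [hgap u hu]

theorem isUnit_one_sub_add_projMatrix {pi : 𝒳 → ℝ} {P : Matrix 𝒳 𝒳 ℝ}
    (hpi : IsInvariantDistrib pi P) (hpos : ∀ x, 0 < pi x) {lamPlus : ℝ} (hlam1 : lamPlus < 1)
    (hgap : ∀ u : 𝒳 → ℝ, (∑ x, pi x * u x) = 0 →
      ∑ x, pi x * u x * P.mulVec u x ≤ lamPlus * ∑ x, pi x * (u x) ^ 2) :
    IsUnit (1 - P + projMatrix pi) := by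
  rw [← Matrix.mulVec_injective_iff_isUnit]
  refine (injective_iff_map_eq_zero (Matrix.mulVecLin (1 - P + projMatrix pi))).2 fun u hu => ?_
  rw [Matrix.mulVecLin_apply] at hu
  have hmean : ∑ x, pi x * u x = 0 := by
    simpa [hu] using (hpi.sum_mul_one_sub_add_projMatrix_mulVec u).symm
  have hharm : ∀ x, u x - P.mulVec u x = 0 := fun x => by
    simpa [one_sub_add_projMatrix_mulVec, hmean] using congrFun hu x
  have hle := dirichlet_lower_bound hgap hmean
  simp only [hharm, mul_zero, Finset.sum_const_zero] at hle
  have hterm : ∀ x ∈ Finset.univ, 0 ≤ pi x * (u x) ^ 2 :=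
    fun x _ => mul_nonneg (hpos x).le (sq_nonneg _)
  have hzero : ∑ x, pi x * (u x) ^ 2 = 0 :=
    le_antisymm (nonpos_of_mul_nonpos_right hle (sub_pos.2 hlam1)) (Finset.sum_nonneg hterm)
  ext x
  have hx := (Finset.sum_eq_zero_iff_of_nonneg hterm).1 hzero x (Finset.mem_univ x)
  simpa [(hpos x).ne'] using hx

omit [DecidableEq 𝒳] in
theorem weighted_cauchy_schwarz {pi : 𝒳 → ℝ} (hpi : ∀ x, 0 ≤ pi x) (u v : 𝒳 → ℝ) :
    (∑ x, pi x * u x * v x) ^ 2 ≤ (∑ x, pi x * (u x) ^ 2) * ∑ x, pi x * (v x) ^ 2 :=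
  Finset.sum_sq_le_sum_mul_sum_of_sq_le_mul _
    (fun x _ => mul_nonneg (hpi x) (sq_nonneg _)) (fun x _ => mul_nonneg (hpi x) (sq_nonneg _))
    fun x _ => (by ring : _ = _).le

/-- The reduced resolvent maps every function to the mean-zero solution of the Poisson
equation. -/
theorem reducedResolvent_poisson {pi : 𝒳 → ℝ} {P : Matrix 𝒳 𝒳 ℝ} (hP : IsStochasticMatrix P)
    (hpi : IsInvariantDistrib pi P) (hM : IsUnit (1 - P + projMatrix pi)) (h : 𝒳 → ℝ) :
    ∑ x, pi x * ((1 - P + projMatrix pi)⁻¹ - projMatrix pi).mulVec h x = 0 ∧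
    ∀ x, ((1 - P + projMatrix pi)⁻¹ - projMatrix pi).mulVec h x -
      P.mulVec (((1 - P + projMatrix pi)⁻¹ - projMatrix pi).mulVec h) x =
        h x - ∑ y, pi y * h y := by
  set M := 1 - P + projMatrix pi with hMdef
  set w := M⁻¹.mulVec h with hw
  have hMw : M.mulVec w = h := by
    rw [hw, Matrix.mulVec_mulVec, Matrix.mul_nonsing_inv _ ((Matrix.isUnit_iff_isUnit_det M).1 hM),
      Matrix.one_mulVec]
  have hmean : ∑ x, pi x * w x = ∑ x, pi x * h x := by
    rw [← hpi.sum_mul_one_sub_add_projMatrix_mulVec w, ← hMdef, hMw]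
  have hZ : (M⁻¹ - projMatrix pi).mulVec h = fun x => w x - ∑ y, pi y * h y := by
    rw [Matrix.sub_mulVec]
    rfl
  rw [hZ]
  constructor
  · simp only [mul_sub, Finset.sum_sub_distrib, ← Finset.sum_mul, hpi.2.1, hmean]
    ring
  · intro x
    have hPw : P.mulVec (fun x => w x - ∑ y, pi y * h y) x = P.mulVec w x - ∑ y, pi y * h y := by
      simp only [Matrix.mulVec, dotProduct, mul_sub, Finset.sum_sub_distrib, ← Finset.sum_mul,
        hP.2 x, one_mul]
    have hx := congrFun hMw x
    rw [hMdef, one_sub_add_projMatrix_mulVec, hmean] at hx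
    rw [hPw]
    linarith

/-- **Properties of `Z = (I - P + Π)⁻¹ - Π` (Section 2.3).** For a finite-state, irreducible,
row-stochastic `P`, reversible with respect to its invariant distribution `pi`, with second
largest eigenvalue `λ₊ < 1` (characterized by the Rayleigh-quotient bound below) and
`‖P - Π‖_pi < 1`: (i) `‖Z h‖_pi ≤ ‖h‖_pi / (1-λ₊)` for all `h`; (ii) `⟨Z f, f⟩_pi ≥ 0` for
every mean-zero `f`; (iii) `⟨Z f, f⟩_pi ≤ pi(f²)/(1-λ₊)` for every mean-zero `f`. -/
theorem reduced_resolvent_bounds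
    (P : Matrix 𝒳 𝒳 ℝ) (pi : 𝒳 → ℝ)
    (hP : IsStochasticMatrix P) (hirr : IsIrreducibleMatrix P)
    (hpi : IsInvariantDistrib pi P) (hrev : IsReversible pi P)
    (lamPlus : ℝ) (hlam1 : lamPlus < 1)
    (hgap : ∀ u : 𝒳 → ℝ, (∑ x, pi x * u x) = 0 →
      ∑ x, pi x * u x * P.mulVec u x ≤ lamPlus * ∑ x, pi x * (u x) ^ 2)
    (hnorm : weightedOpNorm pi (P - projMatrix pi) < 1)
    (Z : Matrix 𝒳 𝒳 ℝ) (hZ : Z = (1 - P + projMatrix pi)⁻¹ - projMatrix pi) :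
    (∀ h : 𝒳 → ℝ,
        Real.sqrt (∑ x, pi x * (Z.mulVec h x) ^ 2) ≤
          Real.sqrt (∑ x, pi x * (h x) ^ 2) / (1 - lamPlus)) ∧
    (∀ f : 𝒳 → ℝ, (∑ x, pi x * f x) = 0 → 0 ≤ ∑ x, pi x * Z.mulVec f x * f x) ∧
    (∀ f : 𝒳 → ℝ, (∑ x, pi x * f x) = 0 →
        ∑ x, pi x * Z.mulVec f x * f x ≤ (∑ x, pi x * (f x) ^ 2) / (1 - lamPlus)) := by
  have hM := isUnit_one_sub_add_projMatrix hpi (hpi.pos hP hirr) hlam1 hgap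
  have hc : 0 < 1 - lamPlus := sub_pos.2 hlam1
  have hnn (u : 𝒳 → ℝ) : 0 ≤ ∑ x, pi x * (u x) ^ 2 :=
    Finset.sum_nonneg fun x _ => mul_nonneg (hpi.1 x) (sq_nonneg _)
  have hlower (h : 𝒳 → ℝ) : (1 - lamPlus) * ∑ x, pi x * (Z.mulVec h x) ^ 2 ≤
      ∑ x, pi x * Z.mulVec h x * h x := by
    obtain ⟨hmean, hpoisson⟩ := reducedResolvent_poisson hP hpi hM h
    rw [← hZ] at hmean hpoisson
    refine (dirichlet_lower_bound hgap hmean).trans_eq ?_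
    simp only [hpoisson]
    simp only [mul_sub, Finset.sum_sub_distrib, ← Finset.sum_mul, hmean, zero_mul, sub_zero]
  have hcs (h : 𝒳 → ℝ) := weighted_cauchy_schwarz hpi.1 (Z.mulVec h) h
  have hinner (h : 𝒳 → ℝ) : 0 ≤ ∑ x, pi x * Z.mulVec h x * h x :=
    (mul_nonneg hc.le (hnn _)).trans (hlower h)
  refine ⟨fun h => ?_, fun f _ => hinner f, fun f _ => ?_⟩
  · have hl := hlower h
    have hS := hcs h
    have hG := hnn (Z.mulVec h)
    have hH := hnn h
    rw [le_div_iff₀ hc]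
    refine Real.le_sqrt_of_sq_le ?_
    rw [mul_pow, Real.sq_sqrt hG]
    rcases hG.eq_or_lt with hG0 | hGpos
    · rwa [← hG0, zero_mul]
    · refine le_of_mul_le_mul_left ?_ hGpos
      nlinarith [pow_le_pow_left₀ (mul_nonneg hc.le hG) hl 2]
  · have hl := hlower f
    have hS := hcs f
    have hF := hnn f
    rw [le_div_iff₀ hc]
    rcases (hinner f).eq_or_lt with h0 | hpos
    · rwa [← h0, zero_mul]
    · refine le_of_mul_le_mul_left ?_ hpos
      nlinarith [mul_le_mul_of_nonneg_right hl hF, mul_le_mul_of_nonneg_left hS hc.le]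
end

section
/- Fix λ ∈ [0,1), a probability distribution π on a standard Borel space (𝒳, ℬ), and a measurable function f : 𝒳 → [−c,+c] with π(f) = 0 and π(f²) = σ². Let {X_i}_{i≥1} be the stationary Markov chain with transition kernel P(x,B) = λ·1(x∈B) + (1−λ)π(B). Then lim_{n→∞} Var( Σ_{i=1}^n f(X_i)/√n ) = σ²·(1+λ)/(1−λ). Consequently, the variance proxy σ²(1+λ)/(1−λ) appearing in the Bernstein inequality for Markov chains with L²-spectral gap 1−λ is optimal. -/
open MeasureTheory ProbabilityTheory Filter Real

/-- `X 0, X 1, X 2, …` is a stationary Markov chain on `Ω` (with trajectory law `μ`)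
with state space `𝒳`, initial (and invariant) distribution `pi` and transition kernel `P`:
each `X i` is measurable, `X 0` has law `pi`, `pi` is `P`-invariant, and the Markov property
holds: conditionally on `X 0, …, X n`, the next state `X (n+1)` has law `P (X n)`. -/
def IsStationaryMarkovChain {Ω 𝒳 : Type*} [MeasurableSpace Ω] [m𝒳 : MeasurableSpace 𝒳]
    (μ : Measure Ω) (X : ℕ → Ω → 𝒳) (pi : Measure 𝒳) (P : ProbabilityTheory.Kernel 𝒳 𝒳) :
    Prop :=
  (∀ i, Measurable (X i)) ∧
  μ.map (X 0) = pi ∧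
  pi.bind (⇑P) = pi ∧
  ∀ (n : ℕ) (B : Set 𝒳), MeasurableSet B →
    (μ[(fun ω => B.indicator (fun _ => (1 : ℝ)) (X (n + 1) ω)) |
        ⨆ i ∈ Finset.range (n + 1), MeasurableSpace.comap (X i) m𝒳])
      =ᵐ[μ] fun ω => (P (X n ω) B).toReal

/-- The `σ`-algebra generated by `X 0, …, X n`. -/
abbrev historySigma {Ω 𝒳 : Type*} [m𝒳 : MeasurableSpace 𝒳] (X : ℕ → Ω → 𝒳) (n : ℕ) :
    MeasurableSpace Ω :=
  ⨆ i ∈ Finset.range (n + 1), MeasurableSpace.comap (X i) m𝒳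

section History

variable {Ω 𝒳 : Type*} [m𝒳 : MeasurableSpace 𝒳] {X : ℕ → Ω → 𝒳}

lemma historySigma_le [mΩ : MeasurableSpace Ω] (hX : ∀ i, Measurable (X i)) (n : ℕ) :
    historySigma X n ≤ mΩ :=
  iSup₂_le fun i _ => (hX i).comap_le

lemma measurable_historySigma {i n : ℕ} (hi : i ≤ n) : Measurable[historySigma X n] (X i) :=
  (comap_measurable (X i)).mono
    (le_iSup₂_of_le i (Finset.mem_range_succ_iff.2 hi) le_rfl) le_rfl

lemma measurable_historySigma_sum_comp {f : 𝒳 → ℝ} (hf : Measurable f) (n : ℕ) :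
    Measurable[historySigma X n] fun ω => ∑ i ∈ Finset.range (n + 1), f (X i ω) :=
  Finset.measurable_fun_sum _ fun _ hi =>
    hf.comp (measurable_historySigma (Finset.mem_range_succ_iff.1 hi))

end History

namespace IsStationaryMarkovChain

variable {Ω 𝒳 : Type*} [MeasurableSpace Ω] [MeasurableSpace 𝒳] {μ : Measure Ω}
  [IsProbabilityMeasure μ] {X : ℕ → Ω → 𝒳} {pi : Measure 𝒳} {P : Kernel 𝒳 𝒳}
  {f : 𝒳 → ℝ} {c r : ℝ}

lemma memLp_comp (h : IsStationaryMarkovChain μ X pi P) (hf : Measurable f)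
    (hfc : ∀ x, |f x| ≤ c) (n : ℕ) : MemLp (fun ω => f (X n ω)) 2 μ :=
  .of_bound (hf.comp (h.1 n)).aestronglyMeasurable c (ae_of_all _ fun _ => hfc _)

lemma memLp_sum_comp (h : IsStationaryMarkovChain μ X pi P) (hf : Measurable f)
    (hfc : ∀ x, |f x| ≤ c) (n : ℕ) :
    MemLp (fun ω => ∑ i ∈ Finset.range n, f (X i ω)) 2 μ :=
  memLp_finsetSum _ fun i _ => h.memLp_comp hf hfc i

variable [IsMarkovKernel P]

lemma map_restrict_succ (h : IsStationaryMarkovChain μ X pi P) {n : ℕ} {A : Set Ω}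
    (hA : MeasurableSet[historySigma X n] A) :
    (μ.restrict A).map (X (n + 1)) = ((μ.restrict A).map (X n)).bind P := by
  obtain ⟨hX, -, -, hM⟩ := h
  have hle := historySigma_le hX n
  ext B hB
  have hBX : MeasurableSet (X (n + 1) ⁻¹' B) := hX (n + 1) hB
  have hPB : Measurable fun x => P x B := P.measurable_coe hB
  rw [Measure.map_apply (hX _) hB, Measure.bind_apply hB P.aemeasurable,
    lintegral_map hPB (hX n)]
  have hfin : ∫⁻ ω in A, P (X n ω) B ∂μ ≠ ⊤ := by
    refine ((lintegral_mono fun ω => prob_le_one).trans_lt ?_).ne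
    simp
  rw [← ENNReal.toReal_eq_toReal_iff' (measure_ne_top _ _) hfin,
    ← integral_toReal (f := fun ω => P (X n ω) B) (hPB.comp (hX n)).aemeasurable
      (ae_of_all _ fun ω => measure_lt_top _ _)]
  have hint : Integrable (fun ω => B.indicator (fun _ => (1 : ℝ)) (X (n + 1) ω)) μ :=
    (integrable_const (1 : ℝ)).indicator hBX
  rw [← setIntegral_congr_ae (hle A hA) ((hM n B hB).mono fun ω hω _ => hω),
    setIntegral_condExp hle hint hA]
  exact (integral_indicator_one hBX).symm

lemma map_eq (h : IsStationaryMarkovChain μ X pi P) (n : ℕ) : μ.map (X n) = pi := by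
  induction n with
  | zero => exact h.2.1
  | succ n ih =>
    have := h.map_restrict_succ (n := n) MeasurableSet.univ
    rwa [Measure.restrict_univ, ih, h.2.2.1] at this

lemma integral_comp (h : IsStationaryMarkovChain μ X pi P) (n : ℕ) {g : 𝒳 → ℝ}
    (hg : Measurable g) : ∫ ω, g (X n ω) ∂μ = ∫ x, g x ∂pi := by
  rw [← h.map_eq n, integral_map (h.1 n).aemeasurable hg.aestronglyMeasurable]

/-- The Markov property for bounded measurable functions of the next state. -/
lemma condExp_comp_succ (h : IsStationaryMarkovChain μ X pi P) (n : ℕ) {g : 𝒳 → ℝ}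
    (hg : Measurable g) (hgc : ∀ x, |g x| ≤ c) :
    μ[fun ω => g (X (n + 1) ω) | historySigma X n] =ᵐ[μ] fun ω => ∫ y, g y ∂P (X n ω) := by
  have hX := h.1
  have hle := historySigma_le hX n
  have hbd (ν : Measure 𝒳) [IsFiniteMeasure ν] : Integrable g ν :=
    .of_bound hg.aestronglyMeasurable c (ae_of_all _ hgc)
  have hPg : StronglyMeasurable fun x => ∫ y, g y ∂P x := hg.stronglyMeasurable.integral_kernel
  have hPgc (x : 𝒳) : ‖∫ y, g y ∂P x‖ ≤ c := by
    simpa using norm_integral_le_of_norm_le_const (μ := P x) (f := g) (C := c) (ae_of_all _ hgc)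
  refine (ae_eq_condExp_of_forall_setIntegral_eq hle
    (.of_bound (hg.comp (hX _)).aestronglyMeasurable c (ae_of_all _ fun _ => hgc _))
    (fun s _ _ => (Integrable.of_bound (hPg.measurable.comp (hX n)).aestronglyMeasurable c
      (ae_of_all _ fun _ => hPgc _)).integrableOn) (fun s hs _ => ?_)
    (hPg.comp_measurable (measurable_historySigma le_rfl)).aestronglyMeasurable).symm
  change ∫ ω in s, (fun x => ∫ y, g y ∂P x) (X n ω) ∂μ = ∫ ω in s, g (X (n + 1) ω) ∂μ
  rw [← integral_map (f := g) (hX (n + 1)).aemeasurable hg.aestronglyMeasurable,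
    h.map_restrict_succ hs,
    ← integral_map (f := fun x => ∫ y, g y ∂P x) (hX n).aemeasurable hPg.aestronglyMeasurable]
  have hcomp := Kernel.integral_comp (η := P)
    (κ := Kernel.const Unit ((μ.restrict s).map (X n))) (a := ()) (hbd _)
  simpa [Kernel.comp_apply] using hcomp.symm

/-- If `f` is an eigenfunction of `P` with eigenvalue `r`, then advancing the chain by one step
multiplies correlations of `f` with the past by `r`. -/
lemma integral_mul_comp_succ (h : IsStationaryMarkovChain μ X pi P) {n : ℕ}
    (hf : Measurable f) (hfc : ∀ x, |f x| ≤ c) (hr : ∀ x, ∫ y, f y ∂P x = r * f x)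
    {Z : Ω → ℝ} (hZ : Measurable[historySigma X n] Z) (hZi : Integrable Z μ) :
    ∫ ω, Z ω * f (X (n + 1) ω) ∂μ = r * ∫ ω, Z ω * f (X n ω) ∂μ := by
  have hle := historySigma_le h.1 n
  have hm : AEStronglyMeasurable (fun ω => f (X (n + 1) ω)) μ :=
    (hf.comp (h.1 _)).aestronglyMeasurable
  have hpull := condExp_mul_of_stronglyMeasurable_left hZ.stronglyMeasurable
    (hZi.mul_bdd hm (ae_of_all _ fun _ => hfc _))
    (.of_bound hm c (ae_of_all _ fun _ => hfc _))
  calc ∫ ω, Z ω * f (X (n + 1) ω) ∂μ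
      = ∫ ω, (μ[Z * fun ω => f (X (n + 1) ω) | historySigma X n]) ω ∂μ :=
        (integral_condExp hle).symm
    _ = ∫ ω, r * (Z ω * f (X n ω)) ∂μ := by
        refine integral_congr_ae ?_
        filter_upwards [hpull, h.condExp_comp_succ n hf hfc] with ω h1 h2
        rw [h1, Pi.mul_apply, h2, hr]
        ring
    _ = r * ∫ ω, Z ω * f (X n ω) ∂μ := integral_const_mul _ _

lemma integral_sum_mul_comp (h : IsStationaryMarkovChain μ X pi P)
    (hf : Measurable f) (hfc : ∀ x, |f x| ≤ c) (hr : ∀ x, ∫ y, f y ∂P x = r * f x) (hr1 : r ≠ 1)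
    (n : ℕ) :
    ∫ ω, (∑ i ∈ Finset.range n, f (X i ω)) * f (X n ω) ∂μ
      = r * (1 - r ^ n) / (1 - r) * ∫ x, f x ^ 2 ∂pi := by
  have hr' : 1 - r ≠ 0 := sub_ne_zero.2 hr1.symm
  induction n with
  | zero => simp
  | succ n ih =>
    rw [h.integral_mul_comp_succ hf hfc hr (measurable_historySigma_sum_comp hf n)
      ((h.memLp_sum_comp hf hfc _).integrable one_le_two)]
    simp_rw [Finset.sum_range_succ, add_mul, ← sq]
    have hY := h.memLp_comp hf hfc n
    have hSY : Integrable (fun ω => (∑ i ∈ Finset.range n, f (X i ω)) * f (X n ω)) μ :=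
      (h.memLp_sum_comp hf hfc n).integrable_mul hY
    rw [integral_add hSY hY.integrable_sq, ih, h.integral_comp n (hf.pow_const 2)]
    field_simp
    ring

lemma integral_sum_sq (h : IsStationaryMarkovChain μ X pi P)
    (hf : Measurable f) (hfc : ∀ x, |f x| ≤ c) (hr : ∀ x, ∫ y, f y ∂P x = r * f x) (hr1 : r ≠ 1)
    (n : ℕ) :
    ∫ ω, (∑ i ∈ Finset.range n, f (X i ω)) ^ 2 ∂μ
      = ∑ k ∈ Finset.range n, (2 * (r * (1 - r ^ k) / (1 - r)) + 1) * ∫ x, f x ^ 2 ∂pi := by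
  induction n with
  | zero => simp
  | succ n ih =>
    have hS := h.memLp_sum_comp hf hfc n
    have hY := h.memLp_comp hf hfc n
    have hSY : Integrable
        (fun ω => 2 * ((∑ i ∈ Finset.range n, f (X i ω)) * f (X n ω))) μ :=
      (hS.integrable_mul hY).const_mul 2
    rw [Finset.sum_range_succ, ← ih]
    simp_rw [Finset.sum_range_succ, add_sq, mul_assoc]
    rw [integral_add (by exact hS.integrable_sq.add hSY) hY.integrable_sq,
      integral_add hS.integrable_sq hSY, integral_const_mul,
      h.integral_sum_mul_comp hf hfc hr hr1, h.integral_comp n (hf.pow_const 2)]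
    ring

/-- The asymptotic variance of an eigenfunction with eigenvalue `r ∈ (-1, 1)`. -/
lemma tendsto_variance_of_eigenfunction (h : IsStationaryMarkovChain μ X pi P)
    (hf : Measurable f) (hfc : ∀ x, |f x| ≤ c) (hf0 : ∫ x, f x ∂pi = 0)
    (hr : ∀ x, ∫ y, f y ∂P x = r * f x) (hr1 : |r| < 1) :
    Tendsto (fun n : ℕ => variance (fun ω => (∑ i ∈ Finset.range n, f (X i ω)) / √n) μ)
      atTop (nhds ((∫ x, f x ^ 2 ∂pi) * (1 + r) / (1 - r))) := by
  have hne : r ≠ 1 := (abs_lt.1 hr1).2.ne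
  have hr' : 1 - r ≠ 0 := sub_ne_zero.2 hne.symm
  have hpow := tendsto_pow_atTop_nhds_zero_of_abs_lt_one hr1
  have hterm := (((((hpow.const_sub 1).const_mul r).div_const (1 - r)).const_mul 2).add_const
    1).mul_const (∫ x, f x ^ 2 ∂pi)
  refine ((hterm.cesaro.congr fun n => ?_).mono_right (le_of_eq ?_))
  · have hmean : ∫ ω, (∑ i ∈ Finset.range n, f (X i ω)) / √n ∂μ = 0 := by
      rw [integral_div, integral_finsetSum _ fun i _ =>
        (h.memLp_comp hf hfc i).integrable one_le_two]
      simp [h.integral_comp _ hf, hf0]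
    rw [variance_of_integral_eq_zero
      ((h.memLp_sum_comp hf hfc n).aestronglyMeasurable.aemeasurable.div_const _) hmean]
    simp_rw [div_pow, Real.sq_sqrt n.cast_nonneg]
    rw [integral_div, h.integral_sum_sq hf hfc hr hne, div_eq_inv_mul]
  · congr 1
    field_simp
    ring

end IsStationaryMarkovChain

/-- **Optimality of the variance proxy (Section 1, via Geyer 1992).** For the stationary
León-Perron chain with kernel `P(x, ·) = λ δ_x + (1-λ) pi`, `λ ∈ [0,1)`, and
`f : 𝒳 → [-c, c]` with `pi(f) = 0` and `pi(f²) = σ²`: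
`Var(Σ_{i<n} f (X i) / √n) → σ² (1+λ)/(1-λ)` as `n → ∞`. Hence the variance proxy
`σ²(1+λ)/(1-λ)` in Bernstein's inequality for Markov chains with `L²`-spectral gap `1-λ`
is optimal. -/
theorem leonPerron_chain_variance_tendsto
    {Ω 𝒳 : Type*} [MeasurableSpace Ω] [MeasurableSpace 𝒳] [StandardBorelSpace 𝒳]
    (μ : Measure Ω) [IsProbabilityMeasure μ] (X : ℕ → Ω → 𝒳)
    (pi : Measure 𝒳) [IsProbabilityMeasure pi]
    (lam : ℝ) (hlam0 : 0 ≤ lam) (hlam1 : lam < 1)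
    (P : ProbabilityTheory.Kernel 𝒳 𝒳) [ProbabilityTheory.IsMarkovKernel P]
    (hP : ∀ x, P x = ENNReal.ofReal lam • Measure.dirac x + ENNReal.ofReal (1 - lam) • pi)
    (hchain : IsStationaryMarkovChain μ X pi P)
    (c : ℝ) (hc : 0 < c) (f : 𝒳 → ℝ) (hfm : Measurable f) (hfb : ∀ x, |f x| ≤ c)
    (hf0 : (∫ x, f x ∂pi) = 0) (σ2 : ℝ) (hσ2 : (∫ x, (f x) ^ 2 ∂pi) = σ2) :
    Tendsto
      (fun n : ℕ =>
        variance (fun ω => (∑ i ∈ Finset.range n, f (X i ω)) / Real.sqrt n) μ)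
      atTop (nhds (σ2 * (1 + lam) / (1 - lam))) := by
  have hint (ν : Measure 𝒳) [IsFiniteMeasure ν] : Integrable f ν :=
    .of_bound hfm.aestronglyMeasurable c (ae_of_all _ hfb)
  have hr (x : 𝒳) : ∫ y, f y ∂P x = lam * f x := by
    rw [hP, integral_add_measure ((hint _).smul_measure ENNReal.ofReal_ne_top)
      ((hint _).smul_measure ENNReal.ofReal_ne_top), integral_smul_measure, integral_smul_measure,
      integral_dirac' _ _ hfm.stronglyMeasurable, hf0, ENNReal.toReal_ofReal hlam0]
    simp
  subst hσ2
  exact hchain.tendsto_variance_of_eigenfunction hfm hfb hf0 hr (abs_lt.2 ⟨by linarith, hlam1⟩)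
end

section
/- For every integer n ≥ 3, Σ_{p=1}^{n} (1/p) · C(n−1, p−1) · C(2p−2, p−1) ≤ 5^{n−2}, where C(a,b) denotes the binomial coefficient. -/
theorem catalan_succ_le_four_mul (n : ℕ) : catalan (n + 1) ≤ 4 * catalan n := by
  have h₁ := succ_mul_catalan_eq_centralBinom n
  have h₂ := succ_mul_catalan_eq_centralBinom (n + 1)
  have h₃ := Nat.succ_mul_centralBinom_succ n
  rw [← h₁, ← h₂] at h₃
  have h : (n + 1) * ((n + 2) * catalan (n + 1)) ≤ (n + 1) * ((n + 2) * (4 * catalan n)) := by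
    nlinarith [Nat.zero_le (catalan n), Nat.zero_le (n * catalan n)]
  exact Nat.le_of_mul_le_mul_left (Nat.le_of_mul_le_mul_left h n.succ_pos) (n + 1).succ_pos

theorem sum_choose_mul_catalan_succ_le (m : ℕ) :
    ∑ i ∈ Finset.range (m + 2), ((m + 1).choose i : ℝ) * catalan i ≤
      5 * ∑ i ∈ Finset.range (m + 1), (m.choose i : ℝ) * catalan i := by
  rw [Finset.sum_choose_succ_mul (fun i _ => (catalan i : ℝ)), ← Finset.sum_add_distrib,
    Finset.mul_sum]
  refine Finset.sum_le_sum fun i _ => ?_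
  have h : (catalan (i + 1) : ℝ) ≤ 4 * catalan i := by exact_mod_cast catalan_succ_le_four_mul i
  nlinarith [mul_le_mul_of_nonneg_left h (Nat.cast_nonneg (α := ℝ) (m.choose i))]

theorem sum_choose_mul_catalan_le (m : ℕ) :
    ∑ i ∈ Finset.range (m + 3), ((m + 2).choose i : ℝ) * catalan i ≤ 5 ^ (m + 1) := by
  induction m with
  | zero => norm_num [Finset.sum_range_succ, catalan_two]
  | succ m ih =>
    calc
      _ ≤ 5 * ∑ i ∈ Finset.range (m + 3), ((m + 2).choose i : ℝ) * catalan i :=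
        sum_choose_mul_catalan_succ_le (m + 2)
      _ ≤ 5 * 5 ^ (m + 1) := by gcongr
      _ = 5 ^ (m + 1 + 1) := by ring

/-- **Combinatorial bound (Lezaud 1998, p. 856).** For every `n ≥ 3`,
`Σ_{p=1}^{n} (1/p) C(n-1, p-1) C(2p-2, p-1) ≤ 5^{n-2}`. -/
theorem sum_choose_mul_choose_div_le (n : ℕ) (hn : 3 ≤ n) :
    ∑ p ∈ Finset.Icc 1 n,
        (((n - 1).choose (p - 1) : ℝ) * ((2 * p - 2).choose (p - 1) : ℝ)) / p ≤
      (5 : ℝ) ^ (n - 2) := by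
  obtain ⟨m, rfl⟩ := Nat.exists_eq_add_of_le' hn
  rw [← Finset.Ico_add_one_right_eq_Icc, Finset.sum_Ico_eq_sum_range]
  refine le_of_eq_of_le (Finset.sum_congr rfl fun i _ => ?_) (sum_choose_mul_catalan_le m)
  have h : ((i + 1 : ℕ) : ℝ) * catalan i = (2 * i).choose i := by
    exact_mod_cast succ_mul_catalan_eq_centralBinom i
  rw [show m + 3 - 1 = m + 2 by lia, show 1 + i - 1 = i by lia, show 2 * (1 + i) - 2 = 2 * i by lia,
    add_comm 1 i, ← h]
  field_simp
end

section
/- Let c > 0, σ > 0 and λ ∈ (0,1), and define g₂(t) = 0 for t ≤ 0, g₂(t) = σ²λt²/(1−λ−5ct) for 0 < t < (1−λ)/(5c), and g₂(t) = +∞ for t ≥ (1−λ)/(5c). Then for every ε ≥ 0, sup_{t∈ℝ} ( tε − g₂(t) ) = (1−λ)ε² / ( 2λσ² · h₂(5cε/(λσ²)) ), where h₂(u) = √(1+u) + u/2 + 1. -/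
/-- Completing the square for the objective `t * ε - b * t ^ 2 / (d - a * t)`, in the parametrization
`ε = b * (s ^ 2 - 1) / a`. -/
theorem mul_sub_div_eq_sub_sq_div {a b d s t : ℝ} (ha : a ≠ 0) (hw : d - a * t ≠ 0) :
    t * (b * (s ^ 2 - 1) / a) - b * t ^ 2 / (d - a * t) =
      d * b * (s - 1) ^ 2 / a ^ 2 - b / a ^ 2 * (((d - a * t) * s - d) ^ 2 / (d - a * t)) := by
  obtain ⟨w, rfl⟩ : ∃ w, d = w + a * t := ⟨d - a * t, by ring⟩
  rw [add_sub_cancel_right] at hw ⊢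
  field_simp
  ring

/-- **Fenchel conjugate of the Markov-dependence correction term.** With
`g₂(t) = 0` for `t ≤ 0`, `g₂(t) = σ²λt²/(1-λ-5ct)` for `0 < t < (1-λ)/(5c)` and
`g₂(t) = +∞` for `t ≥ (1-λ)/(5c)`, for every `ε ≥ 0`,
`sup_{t ∈ ℝ} (tε - g₂(t)) = (1-λ)ε² / (2λσ² h₂(5cε/(λσ²)))` where
`h₂(u) = √(1+u) + u/2 + 1`. -/
theorem fenchel_conjugate_markov_correction (c σ lam : ℝ) (hc : 0 < c) (hσ : 0 < σ)
    (hlam0 : 0 < lam) (hlam1 : lam < 1) (ε : ℝ) (hε : 0 ≤ ε) :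
    (⨆ t : ℝ,
        ((t * ε : ℝ) : EReal) -
          (if t ≤ 0 then (0 : EReal)
           else if t < (1 - lam) / (5 * c) then
             ((σ ^ 2 * lam * t ^ 2 / (1 - lam - 5 * c * t) : ℝ) : EReal)
           else (⊤ : EReal))) =
      (((1 - lam) * ε ^ 2 /
          (2 * lam * σ ^ 2 *
            (Real.sqrt (1 + 5 * c * ε / (lam * σ ^ 2)) +
              5 * c * ε / (lam * σ ^ 2) / 2 + 1)) : ℝ) : EReal) := by
  obtain ⟨a, ha⟩ : ∃ a, a = 5 * c := ⟨_, rfl⟩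
  obtain ⟨b, hb⟩ : ∃ b, b = σ ^ 2 * lam := ⟨_, rfl⟩
  obtain ⟨d, hd⟩ : ∃ d, d = 1 - lam := ⟨_, rfl⟩
  have ha0 : 0 < a := by rw [ha]; positivity
  have hb0 : 0 < b := by rw [hb]; positivity
  have hd0 : 0 < d := by rw [hd]; linarith
  rw [show 2 * lam * σ ^ 2 = 2 * b by rw [hb]; ring, mul_comm lam, ← ha, ← hb, ← hd]
  obtain ⟨s, hs⟩ : ∃ s, s = √(1 + a * ε / b) := ⟨_, rfl⟩
  have hu : 0 ≤ a * ε / b := by positivity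
  have hs1 : 1 ≤ s := by rw [hs, Real.one_le_sqrt]; linarith
  have hs0 : 0 < s := by linarith
  have hss : a * ε / b = s ^ 2 - 1 := by rw [hs, Real.sq_sqrt (by linarith)]; ring
  have hεs : ε = b * (s ^ 2 - 1) / a := by rw [← hss]; field_simp
  have hV : d * ε ^ 2 / (2 * b * (√(1 + a * ε / b) + a * ε / b / 2 + 1)) =
      d * b * (s - 1) ^ 2 / a ^ 2 := by
    rw [← hs, hss, hεs, show s + (s ^ 2 - 1) / 2 + 1 = (s + 1) ^ 2 / 2 by ring]
    field_simp
    ring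
  rw [hV]
  apply le_antisymm
  · refine iSup_le fun t => ?_
    split_ifs with h0 h1
    · rw [sub_zero, EReal.coe_le_coe_iff]
      exact (mul_nonpos_of_nonpos_of_nonneg h0 hε).trans (by positivity)
    · have hw : 0 < d - a * t := by
        rw [lt_div_iff₀ ha0] at h1
        linarith
      rw [← EReal.coe_sub, EReal.coe_le_coe_iff, hεs, mul_sub_div_eq_sub_sq_div ha0.ne' hw.ne']
      exact sub_le_self _ (by positivity)
    · simp
  · rcases hs1.eq_or_lt with rfl | hs1
    · exact le_iSup_of_le 0 (by simp)
    · have ht : 0 < d / a * (1 - 1 / s) :=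
        mul_pos (by positivity) (sub_pos.2 ((div_lt_one hs0).2 hs1))
      have hlt : d / a * (1 - 1 / s) < d / a :=
        mul_lt_of_lt_one_right (by positivity) (sub_lt_self _ (by positivity))
      have hw : d - a * (d / a * (1 - 1 / s)) = d / s := by
        field_simp
        ring
      refine le_iSup_of_le (d / a * (1 - 1 / s)) ?_
      rw [if_neg ht.not_ge, if_pos hlt, ← EReal.coe_sub, EReal.coe_le_coe_iff, hεs,
        mul_sub_div_eq_sub_sq_div ha0.ne' (by rw [hw]; positivity), hw, div_mul_cancel₀ _ hs0.ne']
      simp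
end

section
/- Let c > 0, σ > 0, λ ∈ (0,1) and ε > 0. Then inf{ ε₁²/(2(σ² + cε₁/3)) + ε₂²/(2( (2λ/(1−λ))σ² + 5cε₂/(1−λ) )) : ε₁ + ε₂ = ε, ε₁ ≥ 0, ε₂ ≥ 0 } ≥ ε² / ( 2( ((1+λ)/(1−λ))σ² + 5cε/(1−λ) ) ). -/
/-- The two-term Cauchy–Schwarz inequality in Engel form. -/
theorem add_sq_div_add_le (a b : ℝ) {x y : ℝ} (hx : 0 < x) (hy : 0 < y) :
    (a + b) ^ 2 / (x + y) ≤ a ^ 2 / x + b ^ 2 / y := by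
  rw [div_add_div _ _ hx.ne' hy.ne', div_le_div_iff₀ (add_pos hx hy) (mul_pos hx hy)]
  linarith [sq_nonneg (a * y - b * x)]

/-- **Infimal-convolution lower bound.** For `c > 0`, `σ > 0`, `λ ∈ (0,1)` and `ε > 0`,
`inf { ε₁²/(2(σ² + cε₁/3)) + ε₂²/(2((2λ/(1-λ))σ² + 5cε₂/(1-λ))) :
  ε₁ + ε₂ = ε, ε₁ ≥ 0, ε₂ ≥ 0 } ≥ ε² / (2(((1+λ)/(1-λ))σ² + 5cε/(1-λ)))`. -/
theorem infimal_convolution_ge (c σ lam ε : ℝ) (hc : 0 < c) (hσ : 0 < σ)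
    (hlam0 : 0 < lam) (hlam1 : lam < 1) (hε : 0 < ε) :
    sInf {r : ℝ | ∃ ε₁ ε₂ : ℝ, ε₁ + ε₂ = ε ∧ 0 ≤ ε₁ ∧ 0 ≤ ε₂ ∧
        r = ε₁ ^ 2 / (2 * (σ ^ 2 + c * ε₁ / 3)) +
          ε₂ ^ 2 / (2 * (2 * lam / (1 - lam) * σ ^ 2 + 5 * c * ε₂ / (1 - lam)))} ≥
      ε ^ 2 / (2 * ((1 + lam) / (1 - lam) * σ ^ 2 + 5 * c * ε / (1 - lam))) := by
  refine le_csInf ⟨_, 0, ε, zero_add ε, le_rfl, hε.le, rfl⟩ ?_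
  rintro r ⟨ε₁, ε₂, rfl, h₁, h₂, rfl⟩
  have hl : 0 < 1 - lam := sub_pos.2 hlam1
  have hx : 0 < 2 * (σ ^ 2 + c * ε₁ / 3) := by positivity
  have hy : 0 < 2 * (2 * lam / (1 - lam) * σ ^ 2 + 5 * c * ε₂ / (1 - lam)) := by positivity
  refine le_trans ?_ (add_sq_div_add_le ε₁ ε₂ hx hy)
  refine div_le_div_of_nonneg_left (sq_nonneg _) (add_pos hx hy) ?_
  have hscale : c * ε₁ / 3 ≤ 5 * c * ε₁ / (1 - lam) := by
    rw [div_le_div_iff₀ three_pos hl]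
    nlinarith [mul_nonneg hc.le h₁, mul_nonneg (mul_nonneg hc.le h₁) hlam0.le]
  have hvar : (1 + lam) / (1 - lam) * σ ^ 2 = σ ^ 2 + 2 * lam / (1 - lam) * σ ^ 2 := by
    field_simp
    ring
  have hsplit : 5 * c * (ε₁ + ε₂) / (1 - lam) =
      5 * c * ε₁ / (1 - lam) + 5 * c * ε₂ / (1 - lam) := by ring
  linarith
end
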